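/- Let μ be a Borel probability measure on 𝕋^d with support S, and set S^n := S + S^{n−1} for n ≥ 2. If m is the unique μ-stationary Borel probability measure on 𝕋^d, then the closure of ⋃_{n ≥ 1} S^n equals 𝕋^d. -/

import Mathlib

open MeasureTheory Filter Topology Pointwise

noncomputable section

/-- The `d`-dimensional torus `𝕋^d = (ℝ/ℤ)^d`; `volume` on it is the Haar
probability measure `m`. -/
abbrev Td (d : ℕ) : Type := Fin d → AddCircle (1 : ℝ)

instance : IsProbabilityMeasure (volume : Measure (AddCircle (1:ℝ))) :=
  ⟨by rw [AddCircle.measure_univ]; norm_num⟩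

/-- The topological support of a measure. -/
def msupport {X : Type*} [TopologicalSpace X] [MeasurableSpace X]
    (μ : Measure X) : Set X :=
  {x | ∀ U : Set X, IsOpen U → x ∈ U → 0 < μ U}

/-- `iterSum S n = S^{n+1}`, the Minkowski sum of `n+1` copies of `S`. -/
def iterSum {d : ℕ} (S : Set (Td d)) : ℕ → Set (Td d)
  | 0 => S
  | n + 1 => S + iterSum S n

theorem msupport_eq_support {X : Type*} [TopologicalSpace X] [MeasurableSpace X]
    (μ : Measure X) : msupport μ = μ.support := by
  rw [Measure.support_eq_forall_isOpen]
  ext x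
  exact forall_congr' fun U => forall_comm

theorem iterSum_add_subset {d : ℕ} (S : Set (Td d)) (n m : ℕ) :
    iterSum S n + iterSum S m ⊆ iterSum S (n + m + 1) := by
  induction n with
  | zero => simp [iterSum]
  | succ n ih =>
    rw [show n + 1 + m + 1 = (n + m + 1) + 1 by ring]
    simp only [iterSum]
    rw [add_assoc]
    exact Set.add_subset_add_left ih

/-- A closed nonempty subset of a compact group that is stable under addition contains `0`. -/
theorem zero_mem_of_isClosed_of_add_mem {G : Type*} [AddGroup G] [TopologicalSpace G]
    [CompactSpace G] [IsTopologicalAddGroup G] {T : Set G} (hT : IsClosed T)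
    (hne : T.Nonempty) (hadd : ∀ x ∈ T, ∀ y ∈ T, x + y ∈ T) : (0 : G) ∈ T := by
  obtain ⟨x, hx⟩ := hne
  refine hT.mem_of_mapClusterPt (mapClusterPt_zero_atTop_nsmul x) ?_
  filter_upwards [eventually_ge_atTop 1] with n hn
  induction n, hn using Nat.le_induction with
  | base => simpa using hx
  | succ n _ ih => rw [succ_nsmul]; exact hadd _ ih _ hx

/-- The closure of the union of the iterated sums of a nonempty set is the closed subgroup
generated by that set. -/
theorem closure_iUnion_iterSum {d : ℕ} {S : Set (Td d)} (hS : S.Nonempty) :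
    closure (⋃ n, iterSum S n) = (AddSubgroup.closure S).topologicalClosure := by
  have hadd : ∀ x ∈ closure (⋃ n, iterSum S n), ∀ y ∈ closure (⋃ n, iterSum S n),
      x + y ∈ closure (⋃ n, iterSum S n) := by
    intro x hx y hy
    refine map_mem_closure₂ continuous_add hx hy fun a ha b hb => ?_
    obtain ⟨n, hn⟩ := Set.mem_iUnion.1 ha
    obtain ⟨m, hm⟩ := Set.mem_iUnion.1 hb
    exact Set.mem_iUnion.2 ⟨_, iterSum_add_subset S n m (Set.add_mem_add hn hm)⟩
  have hsub : S ⊆ closure (⋃ n, iterSum S n) :=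
    (Set.subset_iUnion (iterSum S) 0).trans subset_closure
  apply Set.Subset.antisymm
  · refine closure_mono (Set.iUnion_subset fun n => ?_)
    induction n with
    | zero => exact AddSubgroup.subset_closure
    | succ n ih =>
      rintro _ ⟨x, hx, y, hy, rfl⟩
      exact add_mem (AddSubgroup.subset_closure hx) (ih hy)
  · rw [AddSubgroup.topologicalClosure_coe,
      ← closure_addSubmonoidClosure_eq_closure_addSubgroupClosure]
    let M : AddSubmonoid (Td d) :=
      { carrier := closure (⋃ n, iterSum S n)
        add_mem' := fun {x y} hx hy => hadd x hx y hy
        zero_mem' := zero_mem_of_isClosed_of_add_mem isClosed_closure (hS.mono hsub) hadd }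
    exact closure_minimal (AddSubmonoid.closure_le (S := M).2 hsub) isClosed_closure

/-- A measure invariant under almost every translation of `μ` is `μ`-stationary. -/
theorem conv_eq_self_of_ae_map_add_left {G : Type*} [AddMonoid G] [MeasurableSpace G]
    [MeasurableAdd₂ G] {μ ν : Measure G} [IsProbabilityMeasure μ] [SFinite ν]
    (h : ∀ᵐ x ∂μ, ν.map (x + ·) = ν) : Measure.conv μ ν = ν := by
  refine Measure.ext_of_lintegral _ fun f hf => ?_
  rw [Measure.lintegral_conv hf]
  have : ∀ᵐ x ∂μ, ∫⁻ y, f (x + y) ∂ν = ∫⁻ y, f y ∂ν := by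
    filter_upwards [h] with x hx
    conv_rhs => rw [← hx, lintegral_map hf (measurable_const_add x)]
  simp [lintegral_congr_ae this]

/-- A closed subgroup of a compact group carries a probability measure invariant under its translations. -/
theorem exists_isProbabilityMeasure_map_add_left {G : Type*} [AddGroup G] [TopologicalSpace G]
    [CompactSpace G] [IsTopologicalAddGroup G] [MeasurableSpace G] [BorelSpace G]
    (H : AddSubgroup G) (hH : IsClosed (H : Set G)) :
    ∃ ν : Measure G, IsProbabilityMeasure ν ∧ (∀ᵐ x ∂ν, x ∈ H) ∧
      ∀ x ∈ H, ν.map (x + ·) = ν := by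
  have : CompactSpace H := isCompact_iff_compactSpace.1 hH.isCompact
  let η : Measure H := Measure.addHaarMeasure ⊤
  have hη : IsProbabilityMeasure η := ⟨Measure.addHaarMeasure_self (K₀ := ⊤)⟩
  have hval : Measurable (Subtype.val : H → G) := measurable_subtype_coe
  refine ⟨η.map Subtype.val, Measure.isProbabilityMeasure_map hval.aemeasurable, ?_, ?_⟩
  · exact (ae_map_iff hval.aemeasurable hH.measurableSet).2 (ae_of_all _ Subtype.property)
  · intro x hx
    rw [Measure.map_map (measurable_const_add x) hval]
    conv_rhs => rw [← map_add_left_eq_self η ⟨x, hx⟩,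
      Measure.map_map hval (measurable_const_add _)]
    rfl

/-- If the Haar measure `m` is the unique `μ`-stationary
Borel probability measure on `𝕋^d`, then the closure of `⋃_{n ≥ 1} S^n`
equals `𝕋^d`, where `S = supp(μ)`. -/
theorem closure_iterSum_eq_univ_of_unique_stationary {d : ℕ}
    (μ : Measure (Td d)) [IsProbabilityMeasure μ]
    (huniq : ∀ ν : Measure (Td d), IsProbabilityMeasure ν →
      Measure.conv μ ν = ν → ν = volume) :
    closure (⋃ n : ℕ, iterSum (msupport μ) n) = Set.univ := by
  have hS := msupport_eq_support μ
  rw [closure_iUnion_iterSum (hS ▸ Measure.nonempty_support (IsProbabilityMeasure.ne_zero μ))]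
  set H := (AddSubgroup.closure (msupport μ)).topologicalClosure
  have hH : IsClosed (H : Set (Td d)) := isClosed_closure
  obtain ⟨ν, hν, hνH, hinv⟩ := exists_isProbabilityMeasure_map_add_left H hH
  have hμH : ∀ᵐ x ∂μ, x ∈ H := by
    filter_upwards [Measure.support_mem_ae (μ := μ)] with x hx
    exact subset_closure (AddSubgroup.subset_closure (hS ▸ hx))
  have hvol := huniq ν hν (conv_eq_self_of_ae_map_add_left (hμH.mono hinv))
  rw [hvol] at hνH
  rw [← hH.closure_eq]
  exact (Measure.dense_of_ae hνH).closure_eq
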